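/- Let G be a countable group acting ergodically by measure-preserving Borel bijections on a standard probability space (X, μ). If ξ = {C_1, …, C_n} is a collection of pairwise disjoint Borel subsets of X of equal positive measure, then there is a σ_G(ξ)-expressible element θ of the pseudo-group [[E_G^X]] which cyclically permutes the members of ξ: dom(θ) = rng(θ) = ∪ξ, θ(C_k) = C_{k+1} for 1 ≤ k < n, θ(C_n) = C_1, and θ^n is the identity on ∪ξ (all up to μ-null sets). -/

import Mathlib

open MeasureTheory Real ENNReal

section Defs

variable {X : Type*} {mX : MeasurableSpace X}

/-- The smallest `G`-invariant sub-σ-algebra containing the collection `C`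
(together with `X`) and all `μ`-null sets. -/
def sigmaG (G : Type*) [Group G] [MulAction G X] (μ : Measure X) (C : Set (Set X)) :
    MeasurableSpace X :=
  sInf {m : MeasurableSpace X |
    (∀ S ∈ C, MeasurableSet[m] S) ∧
    (∀ S : Set X, MeasurableSet[m] S → ∀ g : G, MeasurableSet[m] ((fun x => g • x) ⁻¹' S)) ∧
    (∀ S : Set X, μ S = 0 → MeasurableSet[m] S)}

/-- The action of `G` on `(X, μ)` is by measure-preserving (Borel) bijections. -/
def IsPmpAction (G : Type*) [Group G] [MulAction G X] (μ : Measure X) : Prop :=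
  ∀ g : G, @MeasurePreserving X X mX mX (fun x : X => g • x) μ μ

/-- The action is ergodic: every `G`-invariant Borel set is null or conull. -/
def IsErgodicAction (G : Type*) [Group G] [MulAction G X] (μ : Measure X) : Prop :=
  ∀ A : Set X, MeasurableSet[mX] A → (∀ g : G, (fun x => g • x) ⁻¹' A = A) →
    μ A = 0 ∨ μ A = 1

/-- A countable Borel partition (as an indexed family): measurable, pairwise
disjoint sets whose union is conull. -/
def IsPartition {ι : Type*} (μ : Measure X) (A : ι → Set X) : Prop :=
  (∀ i, MeasurableSet[mX] (A i)) ∧ Pairwise (Function.onFun Disjoint A) ∧ μ (⋃ i, A i) = 1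

/-- The partition is generating: `σ_G(A)` is the full Borel σ-algebra (up to null
sets; `σ_G(A)` contains all null sets, so this is containment of the Borel sets). -/
def IsGenerating (G : Type*) [Group G] [MulAction G X] {ι : Type*} (μ : Measure X)
    (A : ι → Set X) : Prop :=
  mX ≤ sigmaG G μ (Set.range A)

/-- Shannon entropy of a countable partition, valued in `ℝ≥0∞`. -/
noncomputable def partitionEntropy {ι : Type*} (μ : Measure X) (A : ι → Set X) : ℝ≥0∞ :=
  ∑' i, ENNReal.ofReal (negMulLog (μ (A i)).toReal)

/-- Shannon entropy of a (finite or countable) probability vector, valued in `ℝ≥0∞`. -/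
noncomputable def vecEntropy {ι : Type*} (p : ι → ℝ) : ℝ≥0∞ :=
  ∑' i, ENNReal.ofReal (negMulLog (p i))

/-- Rokhlin entropy: the infimum of the Shannon entropies of countable Borel
generating partitions. -/
noncomputable def rokhlinEntropy (G : Type*) [Group G] [MulAction G X] (μ : Measure X) :
    ℝ≥0∞ :=
  ⨅ (A : ℕ → Set X) (_ : IsPartition μ A ∧ IsGenerating G μ A), partitionEntropy μ A

end Defs

section CyclicPermutation

variable {X : Type*} {mX : MeasurableSpace X} {G : Type*} [Group G] [MulAction G X]
  {μ : Measure X}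

theorem measurableSet_sigmaG_of_mem {C : Set (Set X)} {S : Set X} (hS : S ∈ C) :
    MeasurableSet[sigmaG G μ C] S :=
  MeasurableSpace.measurableSet_sInf.2 fun _ hm => hm.1 S hS

theorem measurableSet_sigmaG_preimage_smul {C : Set (Set X)} {S : Set X}
    (hS : MeasurableSet[sigmaG G μ C] S) (g : G) :
    MeasurableSet[sigmaG G μ C] ((fun x => g • x) ⁻¹' S) :=
  MeasurableSpace.measurableSet_sInf.2 fun m hm =>
    hm.2.1 S (MeasurableSpace.measurableSet_sInf.1 hS m hm) g

theorem IsPmpAction.nullMeasurableSet_of_sigmaG (hpmp : IsPmpAction G μ) {C : Set (Set X)}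
    (hC : ∀ S ∈ C, MeasurableSet S) {S : Set X} (hS : MeasurableSet[sigmaG G μ C] S) :
    NullMeasurableSet S μ := by
  exact MeasurableSpace.measurableSet_sInf.1 hS
    { MeasurableSet' := fun S => NullMeasurableSet S μ
      measurableSet_empty := MeasurableSet.empty.nullMeasurableSet
      measurableSet_compl := fun _ h => h.compl
      measurableSet_iUnion := fun _ h => NullMeasurableSet.iUnion h }
    ⟨fun S hS => (hC S hS).nullMeasurableSet,
      fun S hS g => NullMeasurableSet.preimage hS (hpmp g).quasiMeasurePreserving,
      fun S hS => NullMeasurableSet.of_null hS⟩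

/-- In an ergodic action, two sets one of which misses every translate of the other cannot
both have positive measure. -/
theorem IsErgodicAction.measure_eq_zero_or_of_forall_smul_notMem [Countable G]
    [IsProbabilityMeasure μ] (herg : IsErgodicAction G μ) (hpmp : IsPmpAction G μ)
    {A B : Set X} (hA : NullMeasurableSet A μ) (h : ∀ g : G, ∀ x ∈ A, g • x ∉ B) :
    μ A = 0 ∨ μ B = 0 := by
  obtain ⟨A', hA'A, hA'm, hA'e⟩ := hA.exists_measurable_subset_ae_eq
  have hm : MeasurableSet (⋃ g : G, (fun x => g • x) ⁻¹' A') :=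
    MeasurableSet.iUnion fun g => (hpmp g).measurable hA'm
  have hinv : ∀ h : G, (fun x => h • x) ⁻¹' (⋃ g : G, (fun x => g • x) ⁻¹' A') =
      ⋃ g : G, (fun x => g • x) ⁻¹' A' := by
    intro h
    ext x
    simp only [Set.mem_preimage, Set.mem_iUnion]
    exact ⟨fun ⟨g, hg⟩ => ⟨g * h, by rwa [mul_smul]⟩,
      fun ⟨g, hg⟩ => ⟨g * h⁻¹, by rwa [← mul_smul, inv_mul_cancel_right]⟩⟩
  rcases herg _ hm hinv with h0 | h1
  · left
    rw [← measure_congr hA'e]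
    refine measure_mono_null (fun x hx => Set.mem_iUnion.2 ⟨1, ?_⟩) h0
    simpa using hx
  · right
    refine measure_mono_null (fun x hx => ?_) ((prob_compl_eq_zero_iff hm).2 h1)
    simp only [Set.mem_compl_iff, Set.mem_iUnion, Set.mem_preimage, not_exists]
    intro g hg
    refine h g⁻¹ _ (hA'A hg) ?_
    rwa [inv_smul_smul]

/-- The remainders `(A_i, B_i)` of two sets `A` and `B` when, at each stage `i`, the points of
`A_i` which `γ i` sends into `B_i` are removed together with their images. -/
def greedyRemainder (γ : ℕ → G) (A B : Set X) : ℕ → Set X × Set X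
  | 0 => (A, B)
  | i + 1 =>
    let p := greedyRemainder γ A B i
    (p.1 \ (p.1 ∩ (fun x => γ i • x) ⁻¹' p.2),
      p.2 \ (fun x => (γ i)⁻¹ • x) ⁻¹' (p.1 ∩ (fun x => γ i • x) ⁻¹' p.2))

/-- Two sets of equal measure are equidecomposable, modulo null sets, by pieces lying in any
invariant σ-algebra to which they belong. -/
theorem IsErgodicAction.exists_equidecomposition {X : Type*} (m : MeasurableSpace X)
    {mX : MeasurableSpace X} {G : Type*} [Group G] [MulAction G X] [Countable G]
    {μ : Measure X} [IsProbabilityMeasure μ] (herg : IsErgodicAction G μ) (hpmp : IsPmpAction G μ)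
    {γ : ℕ → G} (hγ : Function.Surjective γ)
    (hsmul : ∀ (g : G) (S : Set X), MeasurableSet[m] S →
      MeasurableSet[m] ((fun x => g • x) ⁻¹' S))
    (hnull : ∀ S, MeasurableSet[m] S → NullMeasurableSet S μ)
    {A B : Set X} (hA : MeasurableSet[m] A) (hB : MeasurableSet[m] B) (hAB : μ A = μ B) :
    ∃ Q : ℕ → Set X, (∀ i, MeasurableSet[m] (Q i)) ∧ (∀ i, Q i ⊆ A) ∧
      Pairwise (Function.onFun Disjoint Q) ∧
      (∀ i, ∀ x ∈ Q i, γ i • x ∈ B) ∧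
      Pairwise (Function.onFun Disjoint fun i => (fun x => (γ i)⁻¹ • x) ⁻¹' Q i) ∧
      μ (A \ ⋃ i, Q i) = 0 ∧ μ (B \ ⋃ i, (fun x => (γ i)⁻¹ • x) ⁻¹' Q i) = 0 := by
  let a : ℕ → Set X := fun i => (greedyRemainder γ A B i).1
  let b : ℕ → Set X := fun i => (greedyRemainder γ A B i).2
  let Q : ℕ → Set X := fun i => a i ∩ (fun x => γ i • x) ⁻¹' b i
  let R : ℕ → Set X := fun i => (fun x => (γ i)⁻¹ • x) ⁻¹' Q i
  have ha : ∀ i, a (i + 1) = a i \ Q i := fun _ => rfl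
  have hb : ∀ i, b (i + 1) = b i \ R i := fun _ => rfl
  have hanti : Antitone a := antitone_nat_of_succ_le fun i => Set.sdiff_subset
  have hbanti : Antitone b := antitone_nat_of_succ_le fun i => Set.sdiff_subset
  have hQa : ∀ i, Q i ⊆ a i := fun i => Set.inter_subset_left
  have hRb : ∀ i, R i ⊆ b i := fun i x hx => by
    have := hx.2
    rwa [Set.mem_preimage, smul_inv_smul] at this
  have hab : ∀ i, MeasurableSet[m] (a i) ∧ MeasurableSet[m] (b i) := by
    intro i
    induction i with
    | zero => exact ⟨hA, hB⟩
    | succ i ih =>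
      have hQ : MeasurableSet[m] (Q i) := ih.1.inter (hsmul _ _ ih.2)
      exact ⟨ih.1.diff hQ, ih.2.diff (hsmul _ _ hQ)⟩
  have hQm : ∀ i, MeasurableSet[m] (Q i) := fun i => (hab i).1.inter (hsmul _ _ (hab i).2)
  have hRm : ∀ i, MeasurableSet[m] (R i) := fun i => hsmul _ _ (hQm i)
  have hQd : Pairwise (Function.onFun Disjoint Q) := by
    refine (pairwise_disjoint_on Q).2 fun i j hij => Set.disjoint_left.2 fun x hi hj => ?_
    exact (hanti (Nat.succ_le_of_lt hij) (hQa j hj)).2 hi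
  have hRd : Pairwise (Function.onFun Disjoint R) := by
    refine (pairwise_disjoint_on R).2 fun i j hij => Set.disjoint_left.2 fun x hi hj => ?_
    exact (hbanti (Nat.succ_le_of_lt hij) (hRb j hj)).2 hi
  have hQA : (⋃ i, Q i) ⊆ A := Set.iUnion_subset fun i => (hQa i).trans (hanti (Nat.zero_le i))
  have hRB : (⋃ i, R i) ⊆ B := Set.iUnion_subset fun i => (hRb i).trans (hbanti (Nat.zero_le i))
  have hra : ∀ i, A \ ⋃ i, Q i ⊆ a i := by
    intro i
    induction i with
    | zero => exact Set.sdiff_subset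
    | succ i ih => exact fun x hx => ⟨ih hx, fun h => hx.2 (Set.mem_iUnion.2 ⟨i, h⟩)⟩
  have hrb : ∀ i, B \ ⋃ i, R i ⊆ b i := by
    intro i
    induction i with
    | zero => exact Set.sdiff_subset
    | succ i ih => exact fun x hx => ⟨ih hx, fun h => hx.2 (Set.mem_iUnion.2 ⟨i, h⟩)⟩
  have hmeas : μ (A \ ⋃ i, Q i) = μ (B \ ⋃ i, R i) := by
    have hQR : ∀ i, μ (R i) = μ (Q i) := fun i =>
      (hpmp (γ i)⁻¹).measure_preimage (hnull _ (hQm i))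
    rw [measure_sdiff hQA (hnull _ (MeasurableSet.iUnion hQm)) (measure_ne_top _ _),
      measure_sdiff hRB (hnull _ (MeasurableSet.iUnion hRm)) (measure_ne_top _ _), hAB,
      measure_iUnion₀ (fun i j hij => (hQd hij).aedisjoint) fun i => hnull _ (hQm i),
      measure_iUnion₀ (fun i j hij => (hRd hij).aedisjoint) fun i => hnull _ (hRm i)]
    simp_rw [hQR]
  have hzero := herg.measure_eq_zero_or_of_forall_smul_notMem hpmp
    (A := A \ ⋃ i, Q i) (B := B \ ⋃ i, R i)
    (hnull _ (hA.diff (MeasurableSet.iUnion hQm))) (by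
      intro g x hx hgx
      obtain ⟨i, rfl⟩ := hγ g
      exact hx.2 (Set.mem_iUnion.2 ⟨i, hra i hx, hrb i hgx⟩))
  refine ⟨Q, hQm, fun i => (hQa i).trans (hanti (Nat.zero_le i)), hQd, fun i x hx => hbanti (Nat.zero_le i) hx.2, hRd, ?_, ?_⟩
  · exact hzero.elim id fun h => hmeas.trans h
  · exact hzero.elim (fun h => hmeas.symm.trans h) id

/-- Given sets `W f` whose translates `c k f • W f` are pairwise disjoint, there is a map moving
`c k f • w` to `c (k + 1) f • w` cyclically in `k` and fixing all other points. -/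
theorem exists_cyclic_map {n : ℕ} (hn : 0 < n) {ι : Type*} (W : ι → Set X)
    (c : Fin n → ι → G)
    (hinj : ∀ k f w k' f' w', w ∈ W f → w' ∈ W f' → c k f • w = c k' f' • w' →
      k = k' ∧ f = f' ∧ w = w') :
    ∃ θ : X → X,
      (∀ k f, ∀ w ∈ W f, θ (c k f • w) = c ⟨((k : ℕ) + 1) % n, Nat.mod_lt _ hn⟩ f • w) ∧
      (∀ y, (∀ k f, ∀ w ∈ W f, c k f • w ≠ y) → θ y = y) ∧
      ∀ y, θ^[n] y = y := by
  let T := {t : Fin n × ι × X // t.2.2 ∈ W t.2.1}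
  let e : T → X := fun t => c t.1.1 t.1.2.1 • t.1.2.2
  let s : T → T := fun t => ⟨(⟨((t.1.1 : ℕ) + 1) % n, Nat.mod_lt _ hn⟩, t.1.2), t.2⟩
  have he : Function.Injective e := by
    rintro ⟨⟨k, f, w⟩, hw⟩ ⟨⟨k', f', w'⟩, hw'⟩ h
    obtain ⟨rfl, rfl, rfl⟩ := hinj k f w k' f' w' hw hw' h
    rfl
  let θ : X → X := Function.extend e (e ∘ s) id
  have hθe : ∀ t, θ (e t) = e (s t) := fun t => he.extend_apply _ _ t
  have hθ : ∀ y, (¬∃ t, e t = y) → θ y = y := fun y hy => Function.extend_apply' _ _ y hy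
  have hs : ∀ j t, s^[j] t = ⟨(⟨((t.1.1 : ℕ) + j) % n, Nat.mod_lt _ hn⟩, t.1.2), t.2⟩ := by
    intro j t
    induction j with
    | zero =>
      refine Subtype.ext (Prod.ext (Fin.ext ?_) rfl)
      simp [Nat.mod_eq_of_lt t.1.1.2]
    | succ j ih =>
      rw [Function.iterate_succ_apply', ih]
      refine Subtype.ext (Prod.ext (Fin.ext ?_) rfl)
      simp [s, add_assoc]
  refine ⟨θ, fun k f w hw => hθe ⟨(k, f, w), hw⟩, fun y hy => hθ y ?_, fun y => ?_⟩
  · rintro ⟨⟨⟨k, f, w⟩, hw⟩, h⟩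
    exact hy k f w hw h
  · by_cases hy : ∃ t, e t = y
    · obtain ⟨t, rfl⟩ := hy
      have hsc : Function.Semiconj e s θ := fun t => (hθe t).symm
      rw [← (hsc.iterate_right n).eq, hs]
      refine congrArg e (Subtype.ext (Prod.ext (Fin.ext ?_) rfl))
      simp [Nat.mod_eq_of_lt t.1.1.2]
    · exact Function.iterate_fixed (hθ y hy) n

end CyclicPermutation

/-- **Corollary (cyclic permutation).** If `ξ = {C_1, …, C_n}` is a collection
of pairwise disjoint Borel sets of equal positive measure, then there is a
`σ_G(ξ)`-expressible pseudo-group element `θ` which cyclically permutes the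
members of `ξ` (mod null) and satisfies `θ^n = id` on `⋃ξ` (mod null). -/
theorem exists_cyclic_permutation
    {X : Type*} [mX : MeasurableSpace X] [StandardBorelSpace X]
    (G : Type*) [Group G] [Countable G] [MulAction G X]
    (μ : Measure X) [IsProbabilityMeasure μ]
    (hpmp : IsPmpAction G μ) (herg : IsErgodicAction G μ)
    (n : ℕ) (hn : 0 < n) (C : Fin n → Set X)
    (hmeasC : ∀ k, MeasurableSet[mX] (C k))
    (hdisj : Pairwise (Function.onFun Disjoint C))
    (hpos : ∀ k, 0 < μ (C k))
    (heq : ∀ k l, μ (C k) = μ (C l)) :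
    ∃ (θ : X → X) (Z : G → Set X),
      (∀ g, MeasurableSet[sigmaG G μ (Set.range C)] (Z g)) ∧
      Pairwise (Function.onFun Disjoint Z) ∧
      (⋃ g, Z g) ⊆ (⋃ k, C k) ∧
      μ ((⋃ k, C k) \ ⋃ g, Z g) = 0 ∧
      (∀ g, ∀ x ∈ Z g, θ x = g • x) ∧
      (∃ N : Set X, μ N = 0 ∧ Set.InjOn θ ((⋃ g, Z g) \ N)) ∧
      (∀ k : Fin n, μ (symmDiff (θ '' C k) (C ⟨((k : ℕ) + 1) % n, Nat.mod_lt _ hn⟩)) = 0) ∧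
      (∀ᵐ x ∂μ, x ∈ (⋃ k, C k) → θ^[n] x = x) := by
  obtain ⟨γ, hγ⟩ := exists_surjective_nat G
  have hCm : ∀ k, MeasurableSet[sigmaG G μ (Set.range C)] (C k) := fun k =>
    measurableSet_sigmaG_of_mem ⟨k, rfl⟩
  choose P hPm hPC0 hPd hPC hRd hP0 hR0 using fun k => herg.exists_equidecomposition
    (sigmaG G μ (Set.range C)) hpmp hγ (fun g S hS => measurableSet_sigmaG_preimage_smul hS g)
    (fun S hS => hpmp.nullMeasurableSet_of_sigmaG (by rintro _ ⟨k, rfl⟩; exact hmeasC k) hS)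
    (hCm ⟨0, hn⟩) (hCm k) (heq ⟨0, hn⟩ k)
  let W : (Fin n → ℕ) → Set X := fun f => ⋂ k, P k (f k)
  let c : Fin n → (Fin n → ℕ) → G := fun k f => γ (f k)
  let next : Fin n → Fin n := fun k => ⟨((k : ℕ) + 1) % n, Nat.mod_lt _ hn⟩
  let V : Fin n → (Fin n → ℕ) → Set X := fun k f => (fun x => (c k f)⁻¹ • x) ⁻¹' W f
  have hVm : ∀ k f, MeasurableSet[sigmaG G μ (Set.range C)] (V k f) := fun k f =>
    measurableSet_sigmaG_preimage_smul (MeasurableSet.iInter fun k => hPm k (f k)) _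
  have hWC : ∀ k f, ∀ w ∈ W f, c k f • w ∈ C k := fun k f w hw =>
    hPC k (f k) w (Set.mem_iInter.1 hw k)
  have hVC : ∀ k f, V k f ⊆ C k := fun k f y hy => by
    simpa using hWC k f _ hy
  have hCinj : ∀ {k l : Fin n} {x : X}, x ∈ C k → x ∈ C l → k = l := fun {k l x} hk hl => by
    by_contra h
    exact Set.disjoint_left.1 (hdisj h) hk hl
  have hinj : ∀ k f w k' f' w', w ∈ W f → w' ∈ W f' → c k f • w = c k' f' • w' →
      k = k' ∧ f = f' ∧ w = w' := by
    intro k f w k' f' w' hw hw' h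
    obtain rfl : k = k' := hCinj (hWC k f w hw) (h ▸ hWC k' f' w' hw')
    have hk : f k = f' k := by
      by_contra hne
      refine Set.disjoint_left.1 (hRd k hne) (?_ : c k f • w ∈ _) ?_
      · simpa [c] using Set.mem_iInter.1 hw k
      · rw [h]
        simpa [c] using Set.mem_iInter.1 hw' k
    obtain rfl : w = w' := by
      simpa [c, hk] using h
    refine ⟨rfl, funext fun j => ?_, rfl⟩
    by_contra hne
    exact Set.disjoint_left.1 (hPd j hne) (Set.mem_iInter.1 hw j) (Set.mem_iInter.1 hw' j)
  have hVinj : ∀ {k f k' f' y}, y ∈ V k f → y ∈ V k' f' → k = k' ∧ f = f' := by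
    intro k f k' f' y hy hy'
    have := hinj k f _ k' f' _ hy hy' (by simp)
    exact ⟨this.1, this.2.1⟩
  have hcover : ∀ k, μ (C k \ ⋃ f, V k f) = 0 := by
    intro k
    refine measure_mono_null (t := (C k \ ⋃ i, (fun x => (γ i)⁻¹ • x) ⁻¹' P k i) ∪
      ⋃ i, ⋃ l, (fun x => (γ i)⁻¹ • x) ⁻¹' (C ⟨0, hn⟩ \ ⋃ j, P l j)) ?_ ?_
    · rintro y ⟨hyC, hyV⟩
      by_contra hy
      simp only [Set.mem_union, Set.mem_sdiff, Set.mem_iUnion, Set.mem_preimage, not_or,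
        not_and, not_exists, not_forall, not_not] at hy
      obtain ⟨i, hi⟩ := hy.1 hyC
      choose f hf using fun l => hy.2 i l (hPC0 k i hi)
      have hfk : f k = i := by
        by_contra hne
        exact Set.disjoint_left.1 (hPd k hne) (hf k) hi
      refine hyV (Set.mem_iUnion.2 ⟨f, Set.mem_iInter.2 fun l => ?_⟩)
      simpa [c, hfk] using hf l
    · refine measure_union_null (hR0 k) (measure_iUnion_null fun i => measure_iUnion_null fun l =>
        (hpmp (γ i)⁻¹).quasiMeasurePreserving.preimage_null (hP0 l))
  obtain ⟨θ, hθ, hθ', hθn⟩ := exists_cyclic_map hn W c hinj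
  have hθV : ∀ k f, ∀ y ∈ V k f, θ y = (c (next k) f * (c k f)⁻¹) • y := by
    intro k f y hy
    simpa [mul_smul] using hθ k f _ hy
  have hθfix : ∀ y, (∀ k f, y ∉ V k f) → θ y = y := by
    refine fun y hy => hθ' y ?_
    rintro k f w hw rfl
    exact hy k f (by simpa [V] using hw)
  have hθC : ∀ k, θ '' (⋃ f, V k f) = ⋃ f, V (next k) f := by
    intro k
    ext y
    simp only [Set.mem_image, Set.mem_iUnion]
    constructor
    · rintro ⟨x, ⟨f, hx⟩, rfl⟩
      exact ⟨f, by rw [hθV k f x hx]; simpa [V, mul_smul] using hx⟩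
    · rintro ⟨f, hy⟩
      refine ⟨c k f • (c (next k) f)⁻¹ • y, ⟨f, by simpa [V] using hy⟩, ?_⟩
      rw [hθ k f _ hy]
      exact smul_inv_smul _ _
  let Z : G → Set X := fun g =>
    ⋃ k, ⋃ f, ⋃ _ : c (next k) f * (c k f)⁻¹ = g, V k f
  have hZ : ∀ {g y}, y ∈ Z g ↔ ∃ k f, c (next k) f * (c k f)⁻¹ = g ∧ y ∈ V k f := by
    intro g y
    simp [Z]
  have hθinj : Function.Injective θ := by
    obtain ⟨j, rfl⟩ : ∃ j, n = j + 1 := ⟨n - 1, by omega⟩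
    exact Function.LeftInverse.injective (g := θ^[j]) fun y => hθn y
  refine ⟨θ, Z, fun g => ?_, fun g g' hg => ?_, ?_, ?_, ?_, ⟨∅, measure_empty, hθinj.injOn⟩, ?_,
    ae_of_all _ fun y _ => hθn y⟩
  · exact MeasurableSet.iUnion fun k => MeasurableSet.iUnion fun f =>
      MeasurableSet.iUnion fun _ => hVm k f
  · refine Set.disjoint_left.2 fun y hy hy' => hg ?_
    obtain ⟨k, f, rfl, h⟩ := hZ.1 hy
    obtain ⟨k', f', rfl, h'⟩ := hZ.1 hy'
    obtain ⟨rfl, rfl⟩ := hVinj h h'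
    rfl
  · refine Set.iUnion_subset fun g y hy => ?_
    obtain ⟨k, f, -, h⟩ := hZ.1 hy
    exact Set.mem_iUnion.2 ⟨k, hVC k f h⟩
  · refine measure_mono_null ?_ (measure_iUnion_null hcover)
    rintro y ⟨hyC, hyZ⟩
    obtain ⟨k, hk⟩ := Set.mem_iUnion.1 hyC
    refine Set.mem_iUnion.2 ⟨k, hk, fun hy => hyZ ?_⟩
    obtain ⟨f, hf⟩ := Set.mem_iUnion.1 hy
    exact Set.mem_iUnion.2 ⟨_, hZ.2 ⟨k, f, rfl, hf⟩⟩
  · intro g y hy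
    obtain ⟨k, f, rfl, h⟩ := hZ.1 hy
    exact hθV k f y h
  · intro k
    refine measure_mono_null ?_ (measure_union_null (hcover k) (hcover (next k)))
    rintro y (⟨⟨x, hx, rfl⟩, hy⟩ | ⟨hyC, hy⟩)
    · by_cases hxV : x ∈ ⋃ f, V k f
      · have hmem : θ x ∈ ⋃ f, V (next k) f := hθC k ▸ Set.mem_image_of_mem θ hxV
        exact absurd (Set.iUnion_subset (hVC (next k)) hmem) hy
      · left
        rw [hθfix x fun l f hl => hxV ?_]
        · exact ⟨hx, hxV⟩
        · obtain rfl := hCinj hx (hVC l f hl)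
          exact Set.mem_iUnion.2 ⟨f, hl⟩
    · refine Or.inr ⟨hyC, fun hyV => hy ?_⟩
      obtain ⟨x, hx, rfl⟩ := (hθC k).symm ▸ hyV
      exact ⟨x, Set.iUnion_subset (hVC k) hx, rfl⟩
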